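/- arXiv:gr-qc/0105032 — 4 statements merged into one kernel-verified Lean document; each statement's English description precedes it below -/
import Mathlib

section
/- Let L be a second-order Lagrangian density that does not depend on the argument q_{00} (i.e. L_{q_{00}} ≡ 0). Let V ⊂ ℝ³ be a compact rectangular box, let φ, ψ : ℝ⁴ → ℝ be smooth with φ satisfying the Euler–Lagrange equations E[φ] = 0 on ℝ × V, and let F : ℝ⁴ → ℝ⁴ be smooth with (d/dε)|_{ε=0} L[φ+εψ](x) = ∂_μ F^μ(x) for all x ∈ ℝ × V. Define δS/δφ_μ := L_{p_μ} − ∂_ν(L_{q_{μν}} + L_{q_{νμ}}). Assume that for every time t the outward flux through the boundary of the box vanishes: ∮_{∂V} [ (δS/δφ_i) ψ + ∂_j( L_{q_{ij}} ψ ) ] n_i dσ = 0, where n is the outward unit normal and the flux is the sum over the six faces of the box. Then the charge Q(t) := ∫_V ( F⁰ − (δS/δφ₀) ψ )(t,·) d³x − ∮_{∂V} (L_{q_{0i}} + L_{q_{i0}}) ψ n_i dσ is constant in t if and only if ∮_{∂V} F^i n_i dσ = 0 for every t. -/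
noncomputable section

/-- Partial derivative of `f : ℝ⁴ → ℝ` in the `μ`-th coordinate direction. -/
def pd (μ : Fin 4) (f : (Fin 4 → ℝ) → ℝ) (x : Fin 4 → ℝ) : ℝ :=
  fderiv ℝ f x (Pi.single μ 1)

/-- A second-order Lagrangian density: a function of `u ∈ ℝ`, `p ∈ ℝ⁴`, `q ∈ ℝ^{4×4}`. -/
abbrev Lagrangian := ℝ → (Fin 4 → ℝ) → (Fin 4 → Fin 4 → ℝ) → ℝ

/-- Smoothness of a Lagrangian density in all its arguments. -/
def SmoothLagrangian (L : Lagrangian) : Prop :=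
  ContDiff ℝ (⊤ : ℕ∞) (fun z : ℝ × (Fin 4 → ℝ) × (Fin 4 → Fin 4 → ℝ) => L z.1 z.2.1 z.2.2)

/-- First derivatives `∂_μ φ` of a field. -/
def jet1 (φ : (Fin 4 → ℝ) → ℝ) (x : Fin 4 → ℝ) : Fin 4 → ℝ := fun μ => pd μ φ x

/-- Second derivatives `∂_μ ∂_ν φ` of a field. -/
def jet2 (φ : (Fin 4 → ℝ) → ℝ) (x : Fin 4 → ℝ) : Fin 4 → Fin 4 → ℝ :=
  fun μ ν => pd μ (pd ν φ) x

/-- The value `L[φ](x)` of the Lagrangian on the 2-jet of `φ`. -/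
def onJet (L : Lagrangian) (φ : (Fin 4 → ℝ) → ℝ) (x : Fin 4 → ℝ) : ℝ :=
  L (φ x) (jet1 φ x) (jet2 φ x)

/-- Partial derivative `L_u` of the Lagrangian with respect to its first argument. -/
def Lu (L : Lagrangian) (u : ℝ) (p : Fin 4 → ℝ) (q : Fin 4 → Fin 4 → ℝ) : ℝ :=
  deriv (fun v => L v p q) u

/-- Partial derivative `L_{p_μ}`. -/
def Lp (L : Lagrangian) (μ : Fin 4) (u : ℝ) (p : Fin 4 → ℝ) (q : Fin 4 → Fin 4 → ℝ) : ℝ :=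
  fderiv ℝ (fun p' => L u p' q) p (Pi.single μ 1)

/-- Partial derivative `L_{q_{μν}}`. -/
def Lq (L : Lagrangian) (μ ν : Fin 4) (u : ℝ) (p : Fin 4 → ℝ) (q : Fin 4 → Fin 4 → ℝ) : ℝ :=
  fderiv ℝ (fun q' => L u p q') q (Pi.single μ (Pi.single ν 1))

/-- `L_u` evaluated on the 2-jet of `φ`. -/
def LuJ (L : Lagrangian) (φ : (Fin 4 → ℝ) → ℝ) (x : Fin 4 → ℝ) : ℝ :=
  Lu L (φ x) (jet1 φ x) (jet2 φ x)

/-- `L_{p_μ}` evaluated on the 2-jet of `φ`. -/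
def LpJ (L : Lagrangian) (μ : Fin 4) (φ : (Fin 4 → ℝ) → ℝ) (x : Fin 4 → ℝ) : ℝ :=
  Lp L μ (φ x) (jet1 φ x) (jet2 φ x)

/-- `L_{q_{μν}}` evaluated on the 2-jet of `φ`. -/
def LqJ (L : Lagrangian) (μ ν : Fin 4) (φ : (Fin 4 → ℝ) → ℝ) (x : Fin 4 → ℝ) : ℝ :=
  Lq L μ ν (φ x) (jet1 φ x) (jet2 φ x)

/-- The Euler–Lagrange expression
`E[φ] = L_u − ∂_μ(L_{p_μ}) + ∂_ν ∂_μ (L_{q_{μν}})`. -/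
def EulerLagrange (L : Lagrangian) (φ : (Fin 4 → ℝ) → ℝ) (x : Fin 4 → ℝ) : ℝ :=
  LuJ L φ x - (∑ μ, pd μ (LpJ L μ φ) x)
    + ∑ μ, ∑ ν, pd ν (pd μ (LqJ L μ ν φ)) x

/-- The first variation `(d/dε)|₀ L[φ + εψ](x)`. -/
def firstVariation (L : Lagrangian) (φ ψ : (Fin 4 → ℝ) → ℝ) (x : Fin 4 → ℝ) : ℝ :=
  deriv (fun ε : ℝ => onJet L (fun y => φ y + ε * ψ y) x) 0

/-- The boundary current
`Θ^μ = (L_{p_μ} − ∂_ν L_{q_{νμ}}) ψ + L_{q_{μν}} ∂_ν ψ`. -/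
def Theta (L : Lagrangian) (φ ψ : (Fin 4 → ℝ) → ℝ) (μ : Fin 4) (x : Fin 4 → ℝ) : ℝ :=
  (LpJ L μ φ x - ∑ ν, pd ν (LqJ L ν μ φ) x) * ψ x
    + ∑ ν, LqJ L μ ν φ x * pd ν ψ x

open MeasureTheory

/-- Integral over the face `{y ∈ [a,b] : y i = c}` of the box `[a,b] ⊂ ℝ³`,
parametrised by the remaining two coordinates. -/
def faceIntegral (a b : Fin 3 → ℝ) (i : Fin 3) (c : ℝ) (f : (Fin 3 → ℝ) → ℝ) : ℝ :=
  ∫ z in Set.Icc (i.removeNth a) (i.removeNth b), f (i.insertNth c z)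

/-- Outward flux of the spatial vector field `G` through the boundary of the box
`[a,b] ⊂ ℝ³`: the sum over `i = 1,2,3` of the integral of `G i` over the face
`y i = b i` minus the integral of `G i` over the face `y i = a i`. -/
def boundaryFlux (a b : Fin 3 → ℝ) (G : Fin 3 → (Fin 3 → ℝ) → ℝ) : ℝ :=
  ∑ i, (faceIntegral a b i (b i) (G i) - faceIntegral a b i (a i) (G i))

/-- The functional derivative `δS/δφ_μ = L_{p_μ} − ∂_ν (L_{q_{μν}} + L_{q_{νμ}})`,
evaluated on the 2-jet of `φ`. -/
def dSdphi (L : Lagrangian) (μ : Fin 4) (φ : (Fin 4 → ℝ) → ℝ) (x : Fin 4 → ℝ) : ℝ :=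
  LpJ L μ φ x - ∑ ν, pd ν (fun y => LqJ L μ ν φ y + LqJ L ν μ φ y) x

/-- The Noether charge
`Q(t) = ∫_V (F⁰ − (δS/δφ₀) ψ)(t,·) d³x − ∮_{∂V} (L_{q_{0i}} + L_{q_{i0}}) ψ n_i dσ`. -/
def noetherCharge (L : Lagrangian) (a b : Fin 3 → ℝ) (φ ψ : (Fin 4 → ℝ) → ℝ)
    (F : (Fin 4 → ℝ) → Fin 4 → ℝ) (t : ℝ) : ℝ :=
  (∫ y in Set.Icc a b,
      (F (Fin.cons t y) 0 - dSdphi L 0 φ (Fin.cons t y) * ψ (Fin.cons t y)))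
    - boundaryFlux a b (fun i y =>
        (LqJ L 0 i.succ φ (Fin.cons t y) + LqJ L i.succ 0 φ (Fin.cons t y))
          * ψ (Fin.cons t y))

theorem hasDerivAt_cons_left (t : ℝ) (y : Fin 3 → ℝ) :
    HasDerivAt (fun s : ℝ => (Fin.cons s y : Fin 4 → ℝ)) (Pi.single 0 1) t := by
  rw [hasDerivAt_pi]
  intro i
  refine Fin.cases ?_ (fun j => ?_) i
  · simpa using hasDerivAt_id' t
  · simpa using hasDerivAt_const t (y j)

/-- The linear inclusion of space into spacetime. -/
def spaceInclusion : (Fin 3 → ℝ) →L[ℝ] (Fin 4 → ℝ) :=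
  ContinuousLinearMap.pi
    (Fin.cases (0 : (Fin 3 → ℝ) →L[ℝ] ℝ) fun j => ContinuousLinearMap.proj j)

theorem spaceInclusion_single (i : Fin 3) :
    spaceInclusion (Pi.single i 1) = Pi.single i.succ 1 := by
  ext k
  refine Fin.cases ?_ (fun j => ?_) k
  · simp [spaceInclusion]
  · simp [spaceInclusion, Pi.single_apply]

theorem hasFDerivAt_cons_right (t : ℝ) (y : Fin 3 → ℝ) :
    HasFDerivAt (fun z : Fin 3 → ℝ => (Fin.cons t z : Fin 4 → ℝ)) spaceInclusion y := by
  rw [hasFDerivAt_pi']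
  intro i
  refine Fin.cases ?_ (fun j => ?_) i
  · simpa [spaceInclusion] using hasFDerivAt_const t y
  · exact hasFDerivAt_apply j y

theorem contDiff_pd {f : (Fin 4 → ℝ) → ℝ} (hf : ContDiff ℝ (⊤ : ℕ∞) f) (μ : Fin 4) :
    ContDiff ℝ (⊤ : ℕ∞) (pd μ f) :=
  (hf.fderiv_right (m := (⊤ : ℕ∞)) (by norm_cast)).clm_apply contDiff_const

section PartialDerivative

variable {f g : (Fin 4 → ℝ) → ℝ}

theorem pd_add (hf : ContDiff ℝ (⊤ : ℕ∞) f) (hg : ContDiff ℝ (⊤ : ℕ∞) g) (μ : Fin 4) :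
    pd μ (fun x => f x + g x) = fun x => pd μ f x + pd μ g x := by
  funext x
  simp [pd, fderiv_fun_add (hf.differentiable (by simp) x) (hg.differentiable (by simp) x)]

theorem pd_sub (hf : ContDiff ℝ (⊤ : ℕ∞) f) (hg : ContDiff ℝ (⊤ : ℕ∞) g) (μ : Fin 4) :
    pd μ (fun x => f x - g x) = fun x => pd μ f x - pd μ g x := by
  funext x
  simp [pd, fderiv_fun_sub (hf.differentiable (by simp) x) (hg.differentiable (by simp) x)]

theorem pd_mul (hf : ContDiff ℝ (⊤ : ℕ∞) f) (hg : ContDiff ℝ (⊤ : ℕ∞) g) (μ : Fin 4) :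
    pd μ (fun x => f x * g x) = fun x => pd μ f x * g x + f x * pd μ g x := by
  funext x
  simp only [pd, fderiv_fun_mul (hf.differentiable (by simp) x) (hg.differentiable (by simp) x),
    add_apply, smul_apply, smul_eq_mul]
  ring

theorem pd_comm (hf : ContDiff ℝ (⊤ : ℕ∞) f) (μ ν : Fin 4) (x : Fin 4 → ℝ) :
    pd μ (pd ν f) x = pd ν (pd μ f) x := by
  have key : ∀ α β : Fin 4, pd α (pd β f) x =
      fderiv ℝ (fderiv ℝ f) x (Pi.single α 1) (Pi.single β 1) := by
    intro α β
    have hd : DifferentiableAt ℝ (fderiv ℝ f) x :=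
      (hf.fderiv_right (m := (⊤ : ℕ∞)) (by norm_cast)).differentiable (by simp) x
    have := hd.hasFDerivAt.clm_apply (hasFDerivAt_const (Pi.single β (1 : ℝ) : Fin 4 → ℝ) x)
    change fderiv ℝ (fun z => fderiv ℝ f z (Pi.single β 1)) x _ = _
    rw [this.fderiv]
    simp
  rw [key, key]
  exact (hf.contDiffAt.isSymmSndFDerivAt (by simp; norm_cast)) _ _

end PartialDerivative

theorem pd_sum {ι : Type*} [Fintype ι] {f : ι → (Fin 4 → ℝ) → ℝ}
    (hf : ∀ i, ContDiff ℝ (⊤ : ℕ∞) (f i)) (μ : Fin 4) :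
    pd μ (fun x => ∑ i, f i x) = fun x => ∑ i, pd μ (f i) x := by
  funext x
  simp [pd, fderiv_fun_sum fun i _ => (hf i).differentiable (by simp) x]

/-- The divergence of the canonical current built from momenta `A` and `B`. -/
theorem divergence_current {A : Fin 4 → (Fin 4 → ℝ) → ℝ} {B : Fin 4 → Fin 4 → (Fin 4 → ℝ) → ℝ}
    {ψ : (Fin 4 → ℝ) → ℝ} (hA : ∀ μ, ContDiff ℝ (⊤ : ℕ∞) (A μ))
    (hB : ∀ μ ν, ContDiff ℝ (⊤ : ℕ∞) (B μ ν)) (hψ : ContDiff ℝ (⊤ : ℕ∞) ψ) (x : Fin 4 → ℝ) :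
    ∑ μ, pd μ (fun x => (A μ x - ∑ ν, pd ν (fun y => B μ ν y + B ν μ y) x) * ψ x
        + ∑ ν, pd ν (fun y => B μ ν y * ψ y) x) x
      = ((∑ μ, pd μ (A μ) x) - ∑ μ, ∑ ν, pd ν (pd μ (B μ ν)) x) * ψ x
        + ∑ μ, A μ x * pd μ ψ x + ∑ μ, ∑ ν, B μ ν x * pd μ (pd ν ψ) x := by
  have h1 : ∀ μ ν, ContDiff ℝ (⊤ : ℕ∞) (fun x => pd ν (B μ ν) x + pd ν (B ν μ) x) :=
    fun μ ν => (contDiff_pd (hB μ ν) ν).add (contDiff_pd (hB ν μ) ν)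
  have h2 : ∀ μ, ContDiff ℝ (⊤ : ℕ∞) (fun x => ∑ ν, (pd ν (B μ ν) x + pd ν (B ν μ) x)) :=
    fun μ => ContDiff.sum fun ν _ => h1 μ ν
  have h3 : ∀ μ ν, ContDiff ℝ (⊤ : ℕ∞) (fun x => pd ν (B μ ν) x * ψ x + B μ ν x * pd ν ψ x) :=
    fun μ ν => ((contDiff_pd (hB μ ν) ν).mul hψ).add ((hB μ ν).mul (contDiff_pd hψ ν))
  have h4 : ∀ μ, ContDiff ℝ (⊤ : ℕ∞)
      (fun x => A μ x - ∑ ν, (pd ν (B μ ν) x + pd ν (B ν μ) x)) :=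
    fun μ => (hA μ).sub (h2 μ)
  have h5 : ∀ μ, ContDiff ℝ (⊤ : ℕ∞)
      (fun x => ∑ ν, (pd ν (B μ ν) x * ψ x + B μ ν x * pd ν ψ x)) :=
    fun μ => ContDiff.sum fun ν _ => h3 μ ν
  have hterm : ∀ μ, pd μ (fun x => (A μ x - ∑ ν, pd ν (fun y => B μ ν y + B ν μ y) x) * ψ x
        + ∑ ν, pd ν (fun y => B μ ν y * ψ y) x) x
      = pd μ (A μ) x * ψ x + A μ x * pd μ ψ x
        + ∑ ν, (B μ ν x * pd μ (pd ν ψ) x - pd μ (pd ν (B ν μ)) x * ψ x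
          + (pd μ (B μ ν) x * pd ν ψ x - pd ν (B ν μ) x * pd μ ψ x)) := by
    intro μ
    simp only [pd_add (hB μ _) (hB _ μ), pd_mul (hB μ _) hψ]
    rw [pd_add ((h4 μ).mul hψ) (h5 μ), pd_mul (h4 μ) hψ, pd_sub (hA μ) (h2 μ), pd_sum (h1 μ),
      pd_sum (h3 μ)]
    have e1 : ∀ ν, pd μ (fun x => pd ν (B μ ν) x + pd ν (B ν μ) x) x
        = pd μ (pd ν (B μ ν)) x + pd μ (pd ν (B ν μ)) x := fun ν =>
      congrFun (pd_add (contDiff_pd (hB μ ν) ν) (contDiff_pd (hB ν μ) ν) μ) x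
    have e2 : ∀ ν, pd μ (fun x => pd ν (B μ ν) x * ψ x + B μ ν x * pd ν ψ x) x
        = pd μ (pd ν (B μ ν)) x * ψ x + pd ν (B μ ν) x * pd μ ψ x
          + (pd μ (B μ ν) x * pd ν ψ x + B μ ν x * pd μ (pd ν ψ) x) := by
      intro ν
      rw [pd_add ((contDiff_pd (hB μ ν) ν).mul hψ) ((hB μ ν).mul (contDiff_pd hψ ν)),
        pd_mul (contDiff_pd (hB μ ν) ν) hψ, pd_mul (hB μ ν) (contDiff_pd hψ ν)]
    simp only [e1, e2, Finset.sum_add_distrib, Finset.sum_sub_distrib, ← Finset.sum_mul]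
    ring
  have s1 : ∑ μ, ∑ ν, pd ν (B ν μ) x * pd μ ψ x = ∑ μ, ∑ ν, pd μ (B μ ν) x * pd ν ψ x :=
    Finset.sum_comm
  have s2 : ∑ μ, ∑ ν, pd μ (pd ν (B ν μ)) x * ψ x = ∑ μ, ∑ ν, pd ν (pd μ (B μ ν)) x * ψ x :=
    Finset.sum_comm
  rw [Finset.sum_congr rfl fun μ _ => hterm μ]
  simp only [Finset.sum_add_distrib, Finset.sum_sub_distrib, sub_mul, Finset.sum_mul, s1, s2]
  ring

section Lagrangian

variable {L : Lagrangian}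

/-- A Lagrangian density as a function on a product space. -/
def uncurried (L : Lagrangian) (z : ℝ × (Fin 4 → ℝ) × (Fin 4 → Fin 4 → ℝ)) : ℝ :=
  L z.1 z.2.1 z.2.2

/-- The 2-jet of a field. -/
def jet (φ : (Fin 4 → ℝ) → ℝ) (x : Fin 4 → ℝ) : ℝ × (Fin 4 → ℝ) × (Fin 4 → Fin 4 → ℝ) :=
  (φ x, jet1 φ x, jet2 φ x)

theorem SmoothLagrangian.hasFDerivAt (hL : SmoothLagrangian L)
    (z : ℝ × (Fin 4 → ℝ) × (Fin 4 → Fin 4 → ℝ)) :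
    HasFDerivAt (uncurried L) (fderiv ℝ (uncurried L) z) z :=
  (ContDiff.differentiable hL (by simp) z).hasFDerivAt

theorem Lu_eq (hL : SmoothLagrangian L) (u : ℝ) (p : Fin 4 → ℝ) (q : Fin 4 → Fin 4 → ℝ) :
    Lu L u p q = fderiv ℝ (uncurried L) (u, p, q) (1, 0, 0) :=
  HasDerivAt.deriv <| (hL.hasFDerivAt (u, p, q)).comp_hasDerivAt (f := fun v => (v, p, q)) u
    ((hasDerivAt_id' u).prodMk (hasDerivAt_const u (p, q)))

theorem Lp_eq (hL : SmoothLagrangian L) (μ : Fin 4) (u : ℝ) (p : Fin 4 → ℝ)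
    (q : Fin 4 → Fin 4 → ℝ) :
    Lp L μ u p q = fderiv ℝ (uncurried L) (u, p, q) (0, Pi.single μ 1, 0) := by
  have h := (hL.hasFDerivAt (u, p, q)).comp (f := fun p' => (u, p', q)) p
    ((hasFDerivAt_const u p).prodMk ((hasFDerivAt_id p).prodMk (hasFDerivAt_const q p)))
  exact congrArg (fun T : (Fin 4 → ℝ) →L[ℝ] ℝ => T (Pi.single μ 1)) h.fderiv

theorem Lq_eq (hL : SmoothLagrangian L) (μ ν : Fin 4) (u : ℝ) (p : Fin 4 → ℝ)
    (q : Fin 4 → Fin 4 → ℝ) :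
    Lq L μ ν u p q
      = fderiv ℝ (uncurried L) (u, p, q) (0, 0, Pi.single μ (Pi.single ν 1)) := by
  have h := (hL.hasFDerivAt (u, p, q)).comp (f := fun q' => (u, p, q')) q
    ((hasFDerivAt_const u q).prodMk ((hasFDerivAt_const p q).prodMk (hasFDerivAt_id q)))
  exact congrArg (fun T : (Fin 4 → Fin 4 → ℝ) →L[ℝ] ℝ => T (Pi.single μ (Pi.single ν 1))) h.fderiv

variable {φ ψ : (Fin 4 → ℝ) → ℝ}

theorem contDiff_jet (hφ : ContDiff ℝ (⊤ : ℕ∞) φ) : ContDiff ℝ (⊤ : ℕ∞) (jet φ) :=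
  hφ.prodMk ((contDiff_pi.2 fun μ => contDiff_pd hφ μ).prodMk
    (contDiff_pi.2 fun μ => contDiff_pi.2 fun ν => contDiff_pd (contDiff_pd hφ ν) μ))

theorem SmoothLagrangian.contDiff_fderiv_jet (hL : SmoothLagrangian L)
    (hφ : ContDiff ℝ (⊤ : ℕ∞) φ) (v : ℝ × (Fin 4 → ℝ) × (Fin 4 → Fin 4 → ℝ)) :
    ContDiff ℝ (⊤ : ℕ∞) (fun x => fderiv ℝ (uncurried L) (jet φ x) v) :=
  ((ContDiff.fderiv_right (f := uncurried L) (m := (⊤ : ℕ∞)) hL (by norm_cast)).comp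
    (contDiff_jet hφ)).clm_apply contDiff_const

theorem contDiff_LpJ (hL : SmoothLagrangian L) (hφ : ContDiff ℝ (⊤ : ℕ∞) φ) (μ : Fin 4) :
    ContDiff ℝ (⊤ : ℕ∞) (LpJ L μ φ) := by
  have : LpJ L μ φ = fun x => fderiv ℝ (uncurried L) (jet φ x) (0, Pi.single μ 1, 0) :=
    funext fun x => Lp_eq hL μ _ _ _
  rw [this]
  exact hL.contDiff_fderiv_jet hφ _

theorem contDiff_LqJ (hL : SmoothLagrangian L) (hφ : ContDiff ℝ (⊤ : ℕ∞) φ) (μ ν : Fin 4) :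
    ContDiff ℝ (⊤ : ℕ∞) (LqJ L μ ν φ) := by
  have : LqJ L μ ν φ
      = fun x => fderiv ℝ (uncurried L) (jet φ x) (0, 0, Pi.single μ (Pi.single ν 1)) :=
    funext fun x => Lq_eq hL μ ν _ _ _
  rw [this]
  exact hL.contDiff_fderiv_jet hφ _

theorem contDiff_dSdphi (hL : SmoothLagrangian L) (hφ : ContDiff ℝ (⊤ : ℕ∞) φ) (μ : Fin 4) :
    ContDiff ℝ (⊤ : ℕ∞) (dSdphi L μ φ) :=
  (contDiff_LpJ hL hφ μ).sub (ContDiff.sum fun ν _ =>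
    contDiff_pd ((contDiff_LqJ hL hφ μ ν).add (contDiff_LqJ hL hφ ν μ)) ν)

theorem pd_add_const_mul (hφ : ContDiff ℝ (⊤ : ℕ∞) φ) (hψ : ContDiff ℝ (⊤ : ℕ∞) ψ) (ε : ℝ)
    (μ : Fin 4) : pd μ (fun y => φ y + ε * ψ y) = fun y => pd μ φ y + ε * pd μ ψ y := by
  rw [pd_add hφ (contDiff_const.mul hψ), pd_mul contDiff_const hψ]
  funext y
  simp [pd]

theorem jet_add_const_mul (hφ : ContDiff ℝ (⊤ : ℕ∞) φ) (hψ : ContDiff ℝ (⊤ : ℕ∞) ψ) (ε : ℝ)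
    (x : Fin 4 → ℝ) : jet (fun y => φ y + ε * ψ y) x = jet φ x + ε • jet ψ x := by
  refine Prod.ext rfl (Prod.ext ?_ ?_)
  · funext μ
    simp [jet, jet1, pd_add_const_mul hφ hψ]
  · funext μ ν
    simp [jet, jet2, pd_add_const_mul hφ hψ,
      pd_add_const_mul (contDiff_pd hφ ν) (contDiff_pd hψ ν)]

theorem firstVariation_eq (hL : SmoothLagrangian L) (hφ : ContDiff ℝ (⊤ : ℕ∞) φ)
    (hψ : ContDiff ℝ (⊤ : ℕ∞) ψ) (x : Fin 4 → ℝ) :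
    firstVariation L φ ψ x = LuJ L φ x * ψ x + ∑ μ, LpJ L μ φ x * pd μ ψ x
      + ∑ μ, ∑ ν, LqJ L μ ν φ x * pd μ (pd ν ψ) x := by
  have hline : HasDerivAt (fun ε : ℝ => jet φ x + ε • jet ψ x) (jet ψ x) 0 := by
    simpa using ((hasDerivAt_id' (0 : ℝ)).smul_const (jet ψ x)).const_add (jet φ x)
  have hder : firstVariation L φ ψ x = fderiv ℝ (uncurried L) (jet φ x) (jet ψ x) := by
    have h0 : HasFDerivAt (uncurried L) (fderiv ℝ (uncurried L) (jet φ x))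
        (jet φ x + (0 : ℝ) • jet ψ x) := by
      simpa using hL.hasFDerivAt (jet φ x)
    have h := h0.comp_hasDerivAt (0 : ℝ) hline
    have he : (fun ε : ℝ => onJet L (fun y => φ y + ε * ψ y) x)
        = uncurried L ∘ fun ε : ℝ => jet φ x + ε • jet ψ x := by
      funext ε
      simp only [Function.comp_apply, ← jet_add_const_mul hφ hψ]
      rfl
    rw [firstVariation, he, h.deriv]
  have hdecomp : jet ψ x = ψ x • (1, 0, 0)
      + ∑ μ, pd μ ψ x • ((0, Pi.single μ 1, 0) : ℝ × (Fin 4 → ℝ) × (Fin 4 → Fin 4 → ℝ))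
      + ∑ μ, ∑ ν, pd μ (pd ν ψ) x •
        ((0, 0, Pi.single μ (Pi.single ν 1)) : ℝ × (Fin 4 → ℝ) × (Fin 4 → Fin 4 → ℝ)) := by
    refine Prod.ext ?_ (Prod.ext ?_ ?_)
    · simp [jet, Prod.fst_sum]
    · funext κ
      simp [jet, jet1, Prod.fst_sum, Prod.snd_sum, Finset.sum_apply, Pi.single_apply]
    · funext κ ρ
      simp [jet, jet2, Prod.snd_sum, Finset.sum_apply, Pi.single_apply, apply_ite]
  rw [hder, hdecomp]
  simp only [map_add, map_sum, map_smul, smul_eq_mul, LuJ, LpJ, LqJ, Lu_eq hL, Lp_eq hL, Lq_eq hL,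
    jet, mul_comm]

/-- The first variation is the Euler–Lagrange expression times the variation, plus the divergence
of the canonical current. -/
theorem firstVariation_eq_eulerLagrange_add_divergence (hL : SmoothLagrangian L)
    (hφ : ContDiff ℝ (⊤ : ℕ∞) φ) (hψ : ContDiff ℝ (⊤ : ℕ∞) ψ) (x : Fin 4 → ℝ) :
    firstVariation L φ ψ x = EulerLagrange L φ x * ψ x
      + ∑ μ, pd μ (fun x => dSdphi L μ φ x * ψ x + ∑ ν, pd ν (fun y => LqJ L μ ν φ y * ψ y) x) x := by
  have h := divergence_current (contDiff_LpJ hL hφ) (contDiff_LqJ hL hφ) hψ x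
  simp only [dSdphi]
  rw [h, firstVariation_eq hL hφ hψ, EulerLagrange]
  ring

end Lagrangian

section Integrals

variable {a b : Fin 3 → ℝ}

theorem hasDerivAt_setIntegral_cons {n : ℕ} {K : Set (Fin n → ℝ)} (hK : IsCompact K)
    {e : (Fin n → ℝ) → Fin 3 → ℝ} (he : Continuous e) {f : (Fin 4 → ℝ) → ℝ}
    (hf : ContDiff ℝ (⊤ : ℕ∞) f) (t : ℝ) :
    HasDerivAt (fun s => ∫ z in K, f (Fin.cons s (e z)))
      (∫ z in K, pd 0 f (Fin.cons t (e z))) t := by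
  have hcons : Continuous fun w : ℝ × (Fin n → ℝ) => (Fin.cons w.1 (e w.2) : Fin 4 → ℝ) :=
    Continuous.finCons (A := fun _ => ℝ) continuous_fst (he.comp continuous_snd)
  have hslice : ∀ s : ℝ, Continuous fun z => (Fin.cons s (e z) : Fin 4 → ℝ) := fun s =>
    continuous_const.finCons he
  have hpd : Continuous (pd 0 f) := (contDiff_pd hf 0).continuous
  obtain ⟨C, hC⟩ := ((isCompact_closedBall t 1).prod hK).exists_bound_of_continuousOn
    (hpd.comp hcons).continuousOn
  refine (hasDerivAt_integral_of_dominated_loc_of_deriv_le (bound := fun _ => C)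
    (F' := fun s z => pd 0 f (Fin.cons s (e z))) (Metric.closedBall_mem_nhds t one_pos)
    (Filter.Eventually.of_forall fun s => (hf.continuous.comp (hslice s)).aestronglyMeasurable)
    ((hf.continuous.comp (hslice t)).continuousOn.integrableOn_compact hK)
    (hpd.comp (hslice t)).aestronglyMeasurable ?_ ?_ ?_).2
  · exact (ae_restrict_mem hK.measurableSet).mono fun z hz s hs => hC (s, z) ⟨hs, hz⟩
  · exact integrableOn_const hK.measure_lt_top.ne
  · exact Filter.Eventually.of_forall fun z s _ =>
      (hf.differentiable (by simp) _).hasFDerivAt.comp_hasDerivAt s (hasDerivAt_cons_left s (e z))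

theorem hasDerivAt_boundaryFlux_cons {G : Fin 3 → (Fin 4 → ℝ) → ℝ}
    (hG : ∀ i, ContDiff ℝ (⊤ : ℕ∞) (G i)) (t : ℝ) :
    HasDerivAt (fun s => boundaryFlux a b fun i y => G i (Fin.cons s y))
      (boundaryFlux a b fun i y => pd 0 (G i) (Fin.cons t y)) t :=
  HasDerivAt.fun_sum fun i _ =>
    (hasDerivAt_setIntegral_cons isCompact_Icc (continuous_const.finInsertNth i continuous_id)
      (hG i) t).sub
    (hasDerivAt_setIntegral_cons isCompact_Icc (continuous_const.finInsertNth i continuous_id)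
      (hG i) t)

theorem boundaryFlux_cons_sub {G H : Fin 3 → (Fin 4 → ℝ) → ℝ}
    (hG : ∀ i, ContDiff ℝ (⊤ : ℕ∞) (G i)) (hH : ∀ i, ContDiff ℝ (⊤ : ℕ∞) (H i)) (t : ℝ) :
    boundaryFlux a b (fun i y => G i (Fin.cons t y) - H i (Fin.cons t y))
      = boundaryFlux a b (fun i y => G i (Fin.cons t y))
        - boundaryFlux a b (fun i y => H i (Fin.cons t y)) := by
  have hface : ∀ (i : Fin 3) (c : ℝ) {f : (Fin 4 → ℝ) → ℝ}, ContDiff ℝ (⊤ : ℕ∞) f →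
      IntegrableOn (fun z => f (Fin.cons t (i.insertNth c z : Fin 3 → ℝ)))
        (Set.Icc (i.removeNth a) (i.removeNth b)) := by
    intro i c f hf
    have hc : Continuous fun z : Fin 2 → ℝ =>
        (Fin.cons t (i.insertNth c z : Fin 3 → ℝ) : Fin 4 → ℝ) :=
      continuous_const.finCons (continuous_const.finInsertNth i continuous_id)
    exact (hf.continuous.comp hc).continuousOn.integrableOn_compact isCompact_Icc
  have key : ∀ i c, faceIntegral a b i c (fun y => G i (Fin.cons t y) - H i (Fin.cons t y))
      = faceIntegral a b i c (fun y => G i (Fin.cons t y))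
        - faceIntegral a b i c (fun y => H i (Fin.cons t y)) := fun i c =>
    integral_sub (hface i c (hG i)) (hface i c (hH i))
  simp only [boundaryFlux, key, ← Finset.sum_sub_distrib]
  exact Finset.sum_congr rfl fun i _ => by ring

theorem setIntegral_divergence_cons (hab : a ≤ b) {G : Fin 3 → (Fin 4 → ℝ) → ℝ}
    (hG : ∀ i, ContDiff ℝ (⊤ : ℕ∞) (G i)) (t : ℝ) :
    ∫ y in Set.Icc a b, ∑ i, pd i.succ (G i) (Fin.cons t y)
      = boundaryFlux a b fun i y => G i (Fin.cons t y) := by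
  have hslice : Continuous fun y : Fin 3 → ℝ => (Fin.cons t y : Fin 4 → ℝ) :=
    continuous_const.finCons continuous_id
  have hpd : ∀ i y, pd i.succ (G i) (Fin.cons t y)
      = ((fderiv ℝ (G i) (Fin.cons t y)).comp spaceInclusion) (Pi.single i 1) := by
    intro i y
    rw [ContinuousLinearMap.comp_apply, spaceInclusion_single]
    rfl
  have hcont : Continuous fun y : Fin 3 → ℝ => ∑ i, pd i.succ (G i) (Fin.cons t y) :=
    continuous_finsetSum _ fun i _ => (contDiff_pd (hG i) i.succ).continuous.comp hslice
  have hint : IntegrableOn (fun y : Fin 3 → ℝ => ∑ i, pd i.succ (G i) (Fin.cons t y))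
      (Set.Icc a b) := hcont.continuousOn.integrableOn_compact isCompact_Icc
  simp only [hpd] at hint ⊢
  exact integral_divergence_of_hasFDerivAt_off_countable' a b hab (fun i y => G i (Fin.cons t y))
    (fun i y => (fderiv ℝ (G i) (Fin.cons t y)).comp spaceInclusion) ∅ Set.countable_empty
    (fun i => ((hG i).continuous.comp hslice).continuousOn)
    (fun y _ i => ((hG i).differentiable (by simp) _).hasFDerivAt.comp y
      (hasFDerivAt_cons_right t y)) hint

end Integrals

/-- The charge changes at the rate at which `F` flows in through the boundary. -/
theorem hasDerivAt_noetherCharge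
    {L : Lagrangian} (hL : SmoothLagrangian L)
    (hq00 : ∀ (u : ℝ) (p : Fin 4 → ℝ) (q : Fin 4 → Fin 4 → ℝ), Lq L 0 0 u p q = 0)
    {a b : Fin 3 → ℝ} (hab : a ≤ b) {φ ψ : (Fin 4 → ℝ) → ℝ}
    (hφ : ContDiff ℝ (⊤ : ℕ∞) φ) (hψ : ContDiff ℝ (⊤ : ℕ∞) ψ) {t : ℝ}
    (hEL : ∀ y ∈ Set.Icc a b, EulerLagrange L φ (Fin.cons t y) = 0)
    {F : (Fin 4 → ℝ) → Fin 4 → ℝ} (hF : ContDiff ℝ (⊤ : ℕ∞) F)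
    (hvar : ∀ y ∈ Set.Icc a b,
      firstVariation L φ ψ (Fin.cons t y) = ∑ μ, pd μ (fun x => F x μ) (Fin.cons t y))
    (hbc : boundaryFlux a b (fun i y =>
        dSdphi L i.succ φ (Fin.cons t y) * ψ (Fin.cons t y)
          + ∑ j : Fin 3, pd j.succ (fun x => LqJ L i.succ j.succ φ x * ψ x)
              (Fin.cons t y)) = 0) :
    HasDerivAt (noetherCharge L a b φ ψ F)
      (-boundaryFlux a b (fun i y => F (Fin.cons t y) i.succ)) t := by
  have hFμ : ∀ μ, ContDiff ℝ (⊤ : ℕ∞) (fun x => F x μ) := contDiff_pi.1 hF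
  have hS : ∀ μ, ContDiff ℝ (⊤ : ℕ∞) (fun x => dSdphi L μ φ x * ψ x) := fun μ =>
    (contDiff_dSdphi hL hφ μ).mul hψ
  have hB : ∀ μ ν, ContDiff ℝ (⊤ : ℕ∞) (fun x => LqJ L μ ν φ x * ψ x) := fun μ ν =>
    (contDiff_LqJ hL hφ μ ν).mul hψ
  have hM : ∀ i : Fin 3, ContDiff ℝ (⊤ : ℕ∞)
      (fun x => (LqJ L 0 i.succ φ x + LqJ L i.succ 0 φ x) * ψ x) := fun i =>
    ((contDiff_LqJ hL hφ _ _).add (contDiff_LqJ hL hφ _ _)).mul hψ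
  have hH : ∀ i : Fin 3, ContDiff ℝ (⊤ : ℕ∞) (fun x => dSdphi L i.succ φ x * ψ x
      + ∑ j : Fin 3, pd j.succ (fun x => LqJ L i.succ j.succ φ x * ψ x) x) := fun i =>
    (hS _).add (ContDiff.sum fun j _ => contDiff_pd (hB _ _) _)
  have hvol := hasDerivAt_setIntegral_cons (K := Set.Icc a b) isCompact_Icc continuous_id
    ((hFμ 0).sub (hS 0)) t
  have hflux := hasDerivAt_boundaryFlux_cons (a := a) (b := b) hM t
  refine (hvol.sub hflux).congr_deriv ?_
  have hB00 : (fun x => LqJ L 0 0 φ x * ψ x) = fun _ => 0 := by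
    funext x
    simp [LqJ, hq00]
  have hpdzero : ∀ μ, pd μ (fun _ : Fin 4 → ℝ => (0 : ℝ)) = fun _ => 0 := fun μ => by
    funext x
    simp [pd]
  have hpoint : ∀ y ∈ Set.Icc a b,
      pd 0 (fun x => F x 0 - dSdphi L 0 φ x * ψ x) (Fin.cons t y)
      = -∑ i : Fin 3, pd i.succ (fun x => (F x i.succ - (dSdphi L i.succ φ x * ψ x
          + ∑ j : Fin 3, pd j.succ (fun x => LqJ L i.succ j.succ φ x * ψ x) x))
          - pd 0 (fun x => (LqJ L 0 i.succ φ x + LqJ L i.succ 0 φ x) * ψ x) x)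
          (Fin.cons t y) := by
    intro y hy
    have h := firstVariation_eq_eulerLagrange_add_divergence hL hφ hψ (Fin.cons t y)
    rw [hvar y hy, hEL y hy, zero_mul, zero_add, Fin.sum_univ_succ (n := 3),
      Fin.sum_univ_succ (n := 3)] at h
    have h0 : pd 0 (fun x => dSdphi L 0 φ x * ψ x + ∑ ν, pd ν (fun y => LqJ L 0 ν φ y * ψ y) x)
        (Fin.cons t y) = pd 0 (fun x => dSdphi L 0 φ x * ψ x) (Fin.cons t y)
          + ∑ i : Fin 3, pd i.succ (pd 0 (fun y => LqJ L 0 i.succ φ y * ψ y)) (Fin.cons t y) := by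
      simp only [Fin.sum_univ_succ (n := 3), hB00, hpdzero, zero_add]
      rw [pd_add (hS 0) (ContDiff.sum fun j _ => contDiff_pd (hB _ _) _),
        pd_sum fun j => contDiff_pd (hB _ _) _]
      simp only [pd_comm (hB 0 _) 0]
    have h1 : ∀ i : Fin 3, pd i.succ (fun x => dSdphi L i.succ φ x * ψ x
          + ∑ ν, pd ν (fun y => LqJ L i.succ ν φ y * ψ y) x) (Fin.cons t y)
        = pd i.succ (fun x => dSdphi L i.succ φ x * ψ x
            + ∑ j : Fin 3, pd j.succ (fun x => LqJ L i.succ j.succ φ x * ψ x) x) (Fin.cons t y)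
          + pd i.succ (pd 0 (fun y => LqJ L i.succ 0 φ y * ψ y)) (Fin.cons t y) := by
      intro i
      rw [← congrFun (pd_add (hH i) (contDiff_pd (hB i.succ 0) 0) i.succ)]
      congr 1
      funext x
      rw [Fin.sum_univ_succ]
      ring
    have h2 : ∀ i : Fin 3, pd 0 (fun x => (LqJ L 0 i.succ φ x + LqJ L i.succ 0 φ x) * ψ x)
        = fun x => pd 0 (fun x => LqJ L 0 i.succ φ x * ψ x) x
          + pd 0 (fun x => LqJ L i.succ 0 φ x * ψ x) x := by
      intro i
      simp only [add_mul]
      exact pd_add (hB _ _) (hB _ _) 0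
    have h3 : ∀ i : Fin 3, pd i.succ (fun x => (F x i.succ - (dSdphi L i.succ φ x * ψ x
          + ∑ j : Fin 3, pd j.succ (fun x => LqJ L i.succ j.succ φ x * ψ x) x))
          - pd 0 (fun x => (LqJ L 0 i.succ φ x + LqJ L i.succ 0 φ x) * ψ x) x) (Fin.cons t y)
        = pd i.succ (fun x => F x i.succ) (Fin.cons t y)
          - pd i.succ (fun x => dSdphi L i.succ φ x * ψ x
            + ∑ j : Fin 3, pd j.succ (fun x => LqJ L i.succ j.succ φ x * ψ x) x) (Fin.cons t y)
          - (pd i.succ (pd 0 (fun x => LqJ L 0 i.succ φ x * ψ x)) (Fin.cons t y)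
            + pd i.succ (pd 0 (fun x => LqJ L i.succ 0 φ x * ψ x)) (Fin.cons t y)) := by
      intro i
      rw [pd_sub ((hFμ _).sub (hH i)) (contDiff_pd (hM i) 0), pd_sub (hFμ _) (hH i), h2,
        pd_add (contDiff_pd (hB _ _) 0) (contDiff_pd (hB _ _) 0)]
    rw [h0] at h
    simp only [h1, Finset.sum_add_distrib] at h
    simp only [h3, Finset.sum_sub_distrib, Finset.sum_add_distrib]
    rw [congrFun (pd_sub (hFμ 0) (hS 0) 0)]
    linarith
  have hbulk : ∫ y in Set.Icc a b, pd 0 (fun x => F x 0 - dSdphi L 0 φ x * ψ x) (Fin.cons t y)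
      = -(boundaryFlux a b (fun i y => F (Fin.cons t y) i.succ)
        - boundaryFlux a b (fun i y =>
          pd 0 (fun x => (LqJ L 0 i.succ φ x + LqJ L i.succ 0 φ x) * ψ x) (Fin.cons t y))) := by
    rw [setIntegral_congr_fun measurableSet_Icc hpoint, integral_neg,
      setIntegral_divergence_cons hab
        (fun i => ((hFμ i.succ).sub (hH i)).sub (contDiff_pd (hM i) 0)),
      boundaryFlux_cons_sub (fun i => (hFμ i.succ).sub (hH i)) (fun i => contDiff_pd (hM i) 0),
      boundaryFlux_cons_sub (fun i => hFμ i.succ) hH, hbc, sub_zero]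
  change (∫ y in Set.Icc a b, pd 0 (fun x => F x 0 - dSdphi L 0 φ x * ψ x) (Fin.cons t y)) - _ = _
  rw [hbulk]
  ring

/-- **Conservation of the Noether charge (Proposition 1).**  Let `L` be a smooth
second-order Lagrangian with `L_{q_{00}} ≡ 0`, let `V = [a,b] ⊂ ℝ³` be a compact box,
let `φ` solve the Euler–Lagrange equations on `ℝ × V`, and let
`(d/dε)|₀ L[φ+εψ] = ∂_μ F^μ` on `ℝ × V`.  Assume the boundary condition
`∮_{∂V} [(δS/δφ_i) ψ + ∂_j (L_{q_{ij}} ψ)] n_i dσ = 0` for every time `t`.  Then the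
charge `Q(t) = ∫_V (F⁰ − (δS/δφ₀)ψ) d³x − ∮_{∂V} (L_{q_{0i}} + L_{q_{i0}}) ψ n_i dσ`
is constant in `t` if and only if `∮_{∂V} F^i n_i dσ = 0` for every `t`. -/
theorem noether_charge_constant_iff_flux_vanishes
    (L : Lagrangian) (hL : SmoothLagrangian L)
    (hq00 : ∀ (u : ℝ) (p : Fin 4 → ℝ) (q : Fin 4 → Fin 4 → ℝ), Lq L 0 0 u p q = 0)
    (a b : Fin 3 → ℝ) (hab : a ≤ b)
    (φ ψ : (Fin 4 → ℝ) → ℝ)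
    (hφ : ContDiff ℝ (⊤ : ℕ∞) φ) (hψ : ContDiff ℝ (⊤ : ℕ∞) ψ)
    (hEL : ∀ t : ℝ, ∀ y ∈ Set.Icc a b, EulerLagrange L φ (Fin.cons t y) = 0)
    (F : (Fin 4 → ℝ) → Fin 4 → ℝ) (hF : ContDiff ℝ (⊤ : ℕ∞) F)
    (hvar : ∀ t : ℝ, ∀ y ∈ Set.Icc a b,
      firstVariation L φ ψ (Fin.cons t y) = ∑ μ, pd μ (fun x => F x μ) (Fin.cons t y))
    (hbc : ∀ t : ℝ,
      boundaryFlux a b (fun i y =>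
        dSdphi L i.succ φ (Fin.cons t y) * ψ (Fin.cons t y)
          + ∑ j : Fin 3, pd j.succ (fun x => LqJ L i.succ j.succ φ x * ψ x)
              (Fin.cons t y)) = 0) :
    (∀ t s : ℝ, noetherCharge L a b φ ψ F t = noetherCharge L a b φ ψ F s)
      ↔ (∀ t : ℝ, boundaryFlux a b (fun i y => F (Fin.cons t y) i.succ) = 0) := by
  have hQ : ∀ t, HasDerivAt (noetherCharge L a b φ ψ F)
      (-boundaryFlux a b (fun i y => F (Fin.cons t y) i.succ)) t := fun t =>
    hasDerivAt_noetherCharge hL hq00 hab hφ hψ (hEL t) hF (hvar t) (hbc t)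
  constructor
  · intro h t
    have hconst : noetherCharge L a b φ ψ F = fun _ => noetherCharge L a b φ ψ F t :=
      funext fun s => h s t
    have h0 := hQ t
    rw [hconst] at h0
    exact neg_eq_zero.1 (h0.unique (hasDerivAt_const t _))
  · intro h
    exact is_const_of_deriv_eq_zero (fun t => (hQ t).differentiableAt) fun t => by
      rw [(hQ t).deriv, h t, neg_zero]

end
end

section
/- Hyperbolic joint-angle identity: let a, b, c : ℝ → ℝ be functions differentiable at t with a(t)·b(t) < 0. Then a(t)·(c/a)′(t) + b(t)·(c/b)′(t) = 2·√( c(t)² − a(t)b(t) ) · ( arcsinh( c/√(−ab) ) )′(t), where arcsinh is the inverse hyperbolic sine and the derivatives on both sides are derivatives at t of the indicated composite functions. -/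
/-- **Hyperbolic joint-angle identity.**  If `a b c : ℝ → ℝ` are differentiable at `t`
and `a t * b t < 0`, then
`a t * (c/a)'(t) + b t * (c/b)'(t) = 2 * √(c t ^ 2 - a t * b t) * (arsinh (c/√(-a*b)))'(t)`. -/
theorem hyperbolic_joint_angle_identity
    (a b c : ℝ → ℝ) (t : ℝ)
    (ha : DifferentiableAt ℝ a t) (hb : DifferentiableAt ℝ b t)
    (hc : DifferentiableAt ℝ c t) (hab : a t * b t < 0) :
    a t * deriv (fun s => c s / a s) t + b t * deriv (fun s => c s / b s) t
      = 2 * Real.sqrt ((c t) ^ 2 - a t * b t)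
        * deriv (fun s => Real.arsinh (c s / Real.sqrt (-(a s * b s)))) t := by
  have hp : 0 < -(a t * b t) := by linarith
  have ha0 : a t ≠ 0 := left_ne_zero_of_mul hab.ne
  have hb0 : b t ≠ 0 := right_ne_zero_of_mul hab.ne
  have hq : 0 < √(-(a t * b t)) := Real.sqrt_pos.2 hp
  have hq2 : √(-(a t * b t)) ^ 2 = -(a t * b t) := Real.sq_sqrt hp.le
  have hderiv := ((hc.hasDerivAt.fun_div
    ((ha.hasDerivAt.fun_mul hb.hasDerivAt).fun_neg.sqrt hp.ne') hq.ne').arsinh).deriv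
  rw [(hc.hasDerivAt.fun_div ha.hasDerivAt ha0).deriv,
    (hc.hasDerivAt.fun_div hb.hasDerivAt hb0).deriv, hderiv]
  have hroot : √(c t ^ 2 - a t * b t)
      = √(-(a t * b t)) * √(1 + (c t / √(-(a t * b t))) ^ 2) := by
    rw [← Real.sqrt_mul hp.le]
    congr 1
    rw [div_pow, hq2]
    field_simp
    ring
  have hr : 0 < √(1 + (c t / √(-(a t * b t))) ^ 2) := Real.sqrt_pos.2 (by positivity)
  rw [hroot]
  generalize √(1 + (c t / √(-(a t * b t))) ^ 2) = r at hr ⊢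
  generalize √(-(a t * b t)) = q at hq hq2 ⊢
  simp only [smul_eq_mul]
  field_simp
  rw [hq2]
  ring
end

section
/- Circular joint-angle identity: let a, b, c : ℝ → ℝ be functions differentiable at t with a(t)·b(t) > 0 and c(t)² < a(t)·b(t). Then a(t)·(c/a)′(t) + b(t)·(c/b)′(t) = 2·√( a(t)b(t) − c(t)² ) · ( arcsin( c/√(ab) ) )′(t), where the derivatives on both sides are derivatives at t of the indicated composite functions. -/
/-- **Circular joint-angle identity.**  If `a b c : ℝ → ℝ` are differentiable at `t`,
`a t * b t > 0` and `c t ^ 2 < a t * b t`, then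
`a t * (c/a)'(t) + b t * (c/b)'(t) = 2 * √(a t * b t - c t ^ 2) * (arcsin (c/√(a*b)))'(t)`. -/
theorem circular_joint_angle_identity
    (a b c : ℝ → ℝ) (t : ℝ)
    (ha : DifferentiableAt ℝ a t) (hb : DifferentiableAt ℝ b t)
    (hc : DifferentiableAt ℝ c t) (hab : 0 < a t * b t) (hc2 : (c t) ^ 2 < a t * b t) :
    a t * deriv (fun s => c s / a s) t + b t * deriv (fun s => c s / b s) t
      = 2 * Real.sqrt (a t * b t - (c t) ^ 2)
        * deriv (fun s => Real.arcsin (c s / Real.sqrt (a s * b s))) t := by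
  have ha0 : a t ≠ 0 := left_ne_zero_of_mul hab.ne'
  have hb0 : b t ≠ 0 := right_ne_zero_of_mul hab.ne'
  set r := √(a t * b t) with hr
  have hr0 : 0 < r := Real.sqrt_pos.mpr hab
  have hr2 : r ^ 2 = a t * b t := Real.sq_sqrt hab.le
  have hx : (c t / r) ^ 2 < 1 := by
    rwa [div_pow, hr2, div_lt_one hab]
  have hcr : HasDerivAt (fun s => c s / √(a s * b s))
      ((deriv c t * r - c t * ((deriv a t * b t + a t * deriv b t) / (2 * r))) / r ^ 2) t :=
    hc.hasDerivAt.div ((ha.hasDerivAt.mul hb.hasDerivAt).sqrt hab.ne') hr0.ne'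
  have harcsin : HasDerivAt (fun s => Real.arcsin (c s / √(a s * b s)))
      (1 / √(1 - (c t / r) ^ 2) *
        ((deriv c t * r - c t * ((deriv a t * b t + a t * deriv b t) / (2 * r))) / r ^ 2)) t :=
    (Real.hasDerivAt_arcsin (by intro h; norm_num [hr, h] at hx)
      (by intro h; norm_num [hr, h] at hx)).comp t hcr
  have hsqrt : √(a t * b t - c t ^ 2) = r * √(1 - (c t / r) ^ 2) := by
    rw [hr, ← Real.sqrt_mul hab.le, ← hr, div_pow, hr2, mul_sub, mul_one,
      mul_div_cancel₀ _ hab.ne']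
  have hw : √(1 - (c t / r) ^ 2) ≠ 0 := (Real.sqrt_pos.mpr (sub_pos.mpr hx)).ne'
  rw [harcsin.deriv, (hc.hasDerivAt.fun_div ha.hasDerivAt ha0).deriv,
    (hc.hasDerivAt.fun_div hb.hasDerivAt hb0).deriv, hsqrt]
  generalize √(1 - (c t / r) ^ 2) = w at hw
  clear_value r
  field_simp
  rw [hr2]
  ring
end

section
/- Jacobi minor identity for the inverse matrix: let A be an invertible n×n real matrix and let i ≠ j be two indices. Then det(A) · ( (A⁻¹)_{ii}(A⁻¹)_{jj} − (A⁻¹)_{ij}(A⁻¹)_{ji} ) equals the determinant of the (n−2)×(n−2) submatrix of A obtained by deleting rows i and j and columns i and j. -/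
/-- **Jacobi's complementary minor identity**: if `M * N = 1`, then `det M` times the minor of `N`
on the second block is the minor of `M` on the first block. -/
theorem Matrix.det_mul_det_toBlocks₂₂_of_mul_eq_one {m n R : Type*} [Fintype m] [Fintype n]
    [DecidableEq m] [DecidableEq n] [CommRing R] {M N : Matrix (m ⊕ n) (m ⊕ n) R}
    (h : M * N = 1) : M.det * N.toBlocks₂₂.det = M.toBlocks₁₁.det := by
  rw [← M.fromBlocks_toBlocks, ← N.fromBlocks_toBlocks, Matrix.fromBlocks_multiply,
    ← Matrix.fromBlocks_one, Matrix.fromBlocks_inj] at h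
  obtain ⟨-, h₁₂, -, h₂₂⟩ := h
  have key : M * Matrix.fromBlocks 1 N.toBlocks₁₂ 0 N.toBlocks₂₂ =
      Matrix.fromBlocks M.toBlocks₁₁ 0 M.toBlocks₂₁ 1 := by
    conv_lhs => rw [← M.fromBlocks_toBlocks, Matrix.fromBlocks_multiply, h₁₂, h₂₂]
    simp
  simpa using congrArg Matrix.det key

/-- **Jacobi minor identity for the inverse matrix.**  Let `A` be an invertible real
matrix of size `(n+2) × (n+2)` and let `i ≠ j` be two indices.  Then
`det A * ((A⁻¹)_{ii} (A⁻¹)_{jj} − (A⁻¹)_{ij} (A⁻¹)_{ji})` equals the determinant of the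
`n × n` submatrix of `A` obtained by deleting rows `i, j` and columns `i, j`
(realised here by reindexing along any strictly monotone map `e : Fin n → Fin (n+2)`
whose range is the complement of `{i, j}`).
(For a spacetime metric this is the identity `g·(g^{μμ}g^{νν} − (g^{μν})²) = γ(μν)`.) -/
theorem det_mul_inv_two_by_two_minor_eq_det_submatrix
    {n : ℕ} (A : Matrix (Fin (n + 2)) (Fin (n + 2)) ℝ) (hA : IsUnit A.det)
    (i j : Fin (n + 2)) (hij : i ≠ j)
    (e : Fin n → Fin (n + 2)) (he : StrictMono e)
    (hrange : Set.range e = ({i, j} : Set (Fin (n + 2)))ᶜ) :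
    A.det * (A⁻¹ i i * A⁻¹ j j - A⁻¹ i j * A⁻¹ j i) = (A.submatrix e e).det := by
  have hmem (x : Fin (n + 2)) : (∃ a, e a = x) ↔ x ≠ i ∧ x ≠ j := by
    simpa using Set.ext_iff.mp hrange x
  have hne (a : Fin n) : e a ≠ i ∧ e a ≠ j := (hmem _).mp ⟨a, rfl⟩
  have hbij : Function.Bijective (Sum.elim e ![i, j]) := by
    constructor
    · refine he.injective.sumElim ?_ ?_
      · intro a b
        fin_cases a <;> fin_cases b <;> simp [hij, hij.symm]
      · intro a b
        fin_cases b <;> simp [hne a]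
    · intro x
      by_cases hx : x ≠ i ∧ x ≠ j
      · obtain ⟨a, rfl⟩ := (hmem x).mpr hx
        exact ⟨.inl a, rfl⟩
      · rcases not_and_or.mp hx with hx | hx
        · exact ⟨.inr 0, (not_not.mp hx).symm⟩
        · exact ⟨.inr 1, (not_not.mp hx).symm⟩
  let E := Equiv.ofBijective _ hbij
  have hmul : A.submatrix E E * A⁻¹.submatrix E E = 1 := by
    rw [Matrix.submatrix_mul_equiv, A.mul_nonsing_inv hA, Matrix.submatrix_one_equiv]
  have := Matrix.det_mul_det_toBlocks₂₂_of_mul_eq_one hmul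
  rw [Matrix.det_submatrix_equiv_self, Matrix.det_fin_two] at this
  exact this
end
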